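/- arXiv:1004.4937 — 4 statements merged into one kernel-verified Lean document; each statement's English description precedes it below -/
import Mathlib

section
/- There exists a finitely generated group Γ with the following property: for every finite subset F ⊆ Γ there exists a function ψ : Γ × Γ → ℤ satisfying the 2-cocycle identity for the trivial action, ψ(g,h) + ψ(gh,k) = ψ(h,k) + ψ(g,hk) for all g,h,k ∈ Γ, such that ψ vanishes on F × F, and ψ is not a coboundary: there is no function φ : Γ → ℤ with ψ(g,h) = φ(h) − φ(gh) + φ(g) for all g,h ∈ Γ. -/
/-- The property required of the group `Γ` in Statement 13: `Γ` is finitely generated, and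
for every finite subset `F ⊆ Γ` there is an integer-valued `2`-cocycle (for the trivial
action) which vanishes on `F × F` but is not a coboundary. -/
def Stmt13Prop (Γ : Type) [Group Γ] : Prop :=
  Group.FG Γ ∧
  ∀ F : Finset Γ, ∃ ψ : Γ → Γ → ℤ,
    (∀ g h k : Γ, ψ g h + ψ (g * h) k = ψ h k + ψ g (h * k)) ∧
    (∀ g ∈ F, ∀ h ∈ F, ψ g h = 0) ∧
    ¬ ∃ φ : Γ → ℤ, ∀ g h : Γ, ψ g h = φ h - φ (g * h) + φ g

open LaurentPolynomial in
/-- The wreath product `ℤ ≀ ℤ`, realised as `ℤ[T;T⁻¹] ⋊ ℤ` where `n` acts as multiplication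
by `T n`. -/
@[ext]
structure IntWreathInt where
  /-- The lamp configuration. -/
  left : ℤ[T;T⁻¹]
  /-- The position of the cursor. -/
  right : ℤ

namespace IntWreathInt

open LaurentPolynomial

noncomputable instance : Mul IntWreathInt := ⟨fun a b => ⟨a.left + T a.right * b.left, a.right + b.right⟩⟩

noncomputable instance : One IntWreathInt := ⟨⟨0, 0⟩⟩

noncomputable instance : Inv IntWreathInt := ⟨fun a => ⟨-(T (-a.right) * a.left), -a.right⟩⟩

@[simp] lemma mul_left (a b : IntWreathInt) : (a * b).left = a.left + T a.right * b.left := rfl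

@[simp] lemma mul_right (a b : IntWreathInt) : (a * b).right = a.right + b.right := rfl

@[simp] lemma one_left : (1 : IntWreathInt).left = 0 := rfl

@[simp] lemma one_right : (1 : IntWreathInt).right = 0 := rfl

@[simp] lemma inv_left (a : IntWreathInt) : a⁻¹.left = -(T (-a.right) * a.left) := rfl

@[simp] lemma inv_right (a : IntWreathInt) : a⁻¹.right = -a.right := rfl

noncomputable instance : Group IntWreathInt where
  mul_assoc a b c := by
    ext1
    · simp only [mul_left, mul_right, T_add]; ring
    · simp [add_assoc]
  one_mul a := by ext1 <;> simp
  mul_one a := by ext1 <;> simp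
  inv_mul_cancel a := by ext1 <;> simp

/-- The embedding of the base group. -/
noncomputable def base : Multiplicative ℤ[T;T⁻¹] →* IntWreathInt where
  toFun f := ⟨f.toAdd, 0⟩
  map_one' := rfl
  map_mul' f g := by ext1 <;> simp

/-- The embedding of the acting group. -/
noncomputable def shift : Multiplicative ℤ →* IntWreathInt where
  toFun n := ⟨0, n.toAdd⟩
  map_one' := rfl
  map_mul' m n := by ext1 <;> simp

lemma base_mul_shift (a : IntWreathInt) :
    base (.ofAdd a.left) * shift (.ofAdd a.right) = a := by
  ext1 <;> simp [base, shift]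

lemma shift_conj_base (n : ℤ) (f : ℤ[T;T⁻¹]) :
    shift (.ofAdd n) * base (.ofAdd f) * (shift (.ofAdd n))⁻¹ = base (.ofAdd (T n * f)) := by
  ext1 <;> simp [base, shift]

lemma closure_eq_top :
    Subgroup.closure {base (.ofAdd 1), shift (.ofAdd 1)} = (⊤ : Subgroup IntWreathInt) := by
  set H := Subgroup.closure {base (.ofAdd 1), shift (.ofAdd 1)} with hH
  have hb : base (.ofAdd 1) ∈ H := Subgroup.subset_closure (by simp)
  have hs (n : ℤ) : shift (.ofAdd n) ∈ H := by
    have h := H.zpow_mem (Subgroup.subset_closure (by simp) : shift (.ofAdd 1) ∈ H) n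
    rwa [← map_zpow, ← ofAdd_zsmul, smul_eq_mul, mul_one] at h
  have hf (f : ℤ[T;T⁻¹]) : base (.ofAdd f) ∈ H := by
    induction f using LaurentPolynomial.induction_on' with
    | add p q hp hq => simpa [ofAdd_add] using H.mul_mem hp hq
    | C_mul_T n c =>
      have h := H.mul_mem (H.mul_mem (hs n) (H.zpow_mem hb c)) (H.inv_mem (hs n))
      rw [← map_zpow, ← ofAdd_zsmul, shift_conj_base] at h
      simpa [mul_comm] using h
  refine eq_top_iff.2 fun a _ => ?_
  rw [← base_mul_shift a]
  exact H.mul_mem (hf _) (hs _)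

instance : Group.FG IntWreathInt :=
  Group.fg_iff.2 ⟨_, closure_eq_top, Set.toFinite _⟩

/-- The universal form of the cocycles considered here, with values in `ℤ[T;T⁻¹]`; on the base
group it is the sesquilinear pairing `(f, g) ↦ invert f * g`. -/
noncomputable def pairing (a b : IntWreathInt) : ℤ[T;T⁻¹] :=
  invert a.left * (T a.right * b.left)

lemma pairing_cocycle (a b c : IntWreathInt) :
    pairing a b + pairing (a * b) c = pairing b c + pairing a (b * c) := by
  have h : (T (-a.right) * T a.right : ℤ[T;T⁻¹]) = 1 := by
    rw [← T_add, neg_add_cancel, T_zero]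
  simp only [pairing, mul_left, mul_right, map_add, map_mul, invert_T, T_add]
  linear_combination (invert b.left * T b.right * c.left) * h

lemma symm_of_coboundary {Γ A : Type*} [Mul Γ] [AddCommGroup A] {ψ : Γ → Γ → A} {φ : Γ → A}
    (hφ : ∀ g h, ψ g h = φ h - φ (g * h) + φ g) {g h : Γ} (hgh : Commute g h) :
    ψ g h = ψ h g := by
  rw [hφ, hφ, hgh.eq]; abel

end IntWreathInt

/-- There is a finitely generated group `Γ` such that for every finite
`F ⊆ Γ` there is a nontrivial `2`-cocycle `ψ : Γ × Γ → ℤ` (trivial action) vanishing on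
`F × F`. -/
theorem stmt_13 : ∃ (Γ : Type) (instΓ : Group Γ), @Stmt13Prop Γ instΓ := by
  refine ⟨IntWreathInt, inferInstance, inferInstance, fun F => ?_⟩
  classical
  obtain ⟨n, hn, hn'⟩ : ∃ n : ℤ, 0 < n ∧
      n ∉ F.biUnion fun g => F.biUnion fun h => (IntWreathInt.pairing g h).coeff.support := by
    obtain ⟨n, hn, hn'⟩ := (Set.Ioi_infinite (0 : ℤ)).exists_notMem_finset
      (F.biUnion fun g => F.biUnion fun h => (IntWreathInt.pairing g h).coeff.support)
    exact ⟨n, hn, hn'⟩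
  refine ⟨fun g h => (IntWreathInt.pairing g h).coeff n, fun g h k => ?_, fun g hg h hh => ?_, ?_⟩
  · simpa using congrArg (fun p => p.coeff n) (IntWreathInt.pairing_cocycle g h k)
  · by_contra hne
    exact hn' (Finset.mem_biUnion.2 ⟨g, hg, Finset.mem_biUnion.2 ⟨h, hh, by simpa using hne⟩⟩)
  · rintro ⟨φ, hφ⟩
    have h := IntWreathInt.symm_of_coboundary hφ (g := IntWreathInt.base (.ofAdd 1))
      (h := IntWreathInt.base (.ofAdd (LaurentPolynomial.T n)))
      ((Commute.all _ _).map IntWreathInt.base)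
    have hne : -n ≠ n := by omega
    simp [IntWreathInt.pairing, IntWreathInt.base, hne] at h
end

section
/- There exist a finitely generated group Γ and a function ψ : Γ × Γ → ⊕_{n∈ℕ} ℤ (the direct sum, i.e., finitely supported integer sequences) satisfying the 2-cocycle identity for the trivial action, such that for every n ∈ ℕ and every function φ : Γ → ⊕_{n∈ℕ} ℤ, the function ψ − dφ does not take all of its values in the subgroup of elements supported on the first n coordinates. (That is, identifying ℤ^n with initial-coordinate subgroups of ℤ^{⊕∞}, the direct limit of the inclusion-induced maps H²(Γ, ℤ^n) → H²(Γ, ℤ^{⊕∞}) is not surjective.) -/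
/-- The property required in Statement 14: there is a `2`-cocycle (for the trivial action)
`ψ : Γ × Γ → ⊕_ℕ ℤ` such that for no `n` and no `φ : Γ → ⊕_ℕ ℤ` does `ψ − dφ` take all its
values in the subgroup of elements supported on the first `n` coordinates. -/
def Stmt14Prop (Γ : Type) [Group Γ] : Prop :=
  Group.FG Γ ∧
  ∃ ψ : Γ → Γ → (ℕ →₀ ℤ),
    (∀ g h k : Γ, ψ g h + ψ (g * h) k = ψ h k + ψ g (h * k)) ∧
    ∀ (n : ℕ) (φ : Γ → (ℕ →₀ ℤ)),
      ¬ ∀ (g h : Γ) (j : ℕ), n ≤ j →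
          (ψ g h - (φ h - φ (g * h) + φ g)) j = 0

/-- The matrices `!![1, f, *; 0, u, g; 0, 0, 1]` with `u` a unit, modulo their top right corner. -/
@[ext]
structure UnitriangularModCorner (R : Type) [CommRing R] where
  /-- the entry in position `(1, 2)` -/
  upper : R
  /-- the entry in position `(2, 2)` -/
  diag : Rˣ
  /-- the entry in position `(2, 3)` -/
  right : R

namespace UnitriangularModCorner

variable {R : Type} [CommRing R]

instance : Mul (UnitriangularModCorner R) :=
  ⟨fun a b => ⟨b.upper + a.upper * b.diag, a.diag * b.diag, a.diag * b.right + a.right⟩⟩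

instance : One (UnitriangularModCorner R) := ⟨⟨0, 1, 0⟩⟩

instance : Inv (UnitriangularModCorner R) :=
  ⟨fun a => ⟨-(a.upper * ↑a.diag⁻¹), a.diag⁻¹, -(↑a.diag⁻¹ * a.right)⟩⟩

@[simp] lemma mul_def (a b : UnitriangularModCorner R) :
    a * b = ⟨b.upper + a.upper * b.diag, a.diag * b.diag, a.diag * b.right + a.right⟩ := rfl

@[simp] lemma one_def : (1 : UnitriangularModCorner R) = ⟨0, 1, 0⟩ := rfl

@[simp] lemma inv_def (a : UnitriangularModCorner R) :
    a⁻¹ = ⟨-(a.upper * ↑a.diag⁻¹), a.diag⁻¹, -(↑a.diag⁻¹ * a.right)⟩ := rfl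

instance : Group (UnitriangularModCorner R) :=
  Group.ofLeftAxioms
    (fun a b c => by ext <;> simp <;> ring)
    (fun a => by ext <;> simp)
    (fun a => by ext <;> simp)

/-- The embedding of the units as diagonal matrices. -/
def ofUnit : Rˣ →* UnitriangularModCorner R where
  toFun u := ⟨0, u, 0⟩
  map_one' := rfl
  map_mul' u v := by simp

/-- The corner entry of a product of two matrices with zero corner. -/
def cornerCocycle (a b : UnitriangularModCorner R) : R := a.upper * b.right

lemma cornerCocycle_add (a b c : UnitriangularModCorner R) :
    cornerCocycle a b + cornerCocycle (a * b) c =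
      cornerCocycle b c + cornerCocycle a (b * c) := by
  simp only [cornerCocycle, mul_def]
  ring

/-- The subgroup generated by the two elementary matrices and the diagonal matrix of `u`. -/
def generatedBy (u : Rˣ) : Subgroup (UnitriangularModCorner R) :=
  Subgroup.closure {⟨1, 1, 0⟩, ofUnit u, ⟨0, 1, 1⟩}

lemma fg_generatedBy (u : Rˣ) : Group.FG (generatedBy u) :=
  (Group.fg_iff_subgroup_fg _).2 ((Subgroup.fg_iff _).2 ⟨_, rfl, by simp⟩)

lemma right_mem_generatedBy (u : Rˣ) : ⟨0, 1, 1⟩ ∈ generatedBy u :=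
  Subgroup.subset_closure (by simp)

lemma upper_zpow_mem_generatedBy (u : Rˣ) (k : ℤ) : ⟨↑(u ^ k), 1, 0⟩ ∈ generatedBy u := by
  have h₁ : ⟨1, 1, 0⟩ ∈ generatedBy u := Subgroup.subset_closure (by simp)
  have h₂ : ofUnit (u ^ k) ∈ generatedBy u := by
    rw [map_zpow]
    exact zpow_mem (Subgroup.subset_closure (by simp)) k
  convert mul_mem (mul_mem (inv_mem h₂) h₁) h₂ using 1
  ext <;> simp [ofUnit]

end UnitriangularModCorner

/-- The antisymmetrization of `ψ` on commuting elements does not change when a coboundary is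
subtracted from `ψ`. -/
lemma sub_coboundary_sub_swap {Γ B : Type} [Group Γ] [AddCommGroup B] (ψ : Γ → Γ → B)
    (φ : Γ → B) {g h : Γ} (hgh : g * h = h * g) :
    (ψ g h - (φ h - φ (g * h) + φ g)) - (ψ h g - (φ g - φ (h * g) + φ h)) =
      ψ g h - ψ h g := by
  rw [hgh]
  abel

namespace LaurentPolynomial

/-- The variable of a Laurent polynomial ring, as a unit. -/
noncomputable def unitT : ℤ[T;T⁻¹]ˣ :=
  ⟨T 1, T (-1), by rw [← T_add, add_neg_cancel, T_zero],
    by rw [← T_add, neg_add_cancel, T_zero]⟩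

lemma val_unitT_zpow (k : ℤ) : ((unitT ^ k : ℤ[T;T⁻¹]ˣ) : ℤ[T;T⁻¹]) = T k := by
  cases k with
  | ofNat n => simp [unitT]
  | negSucc n =>
    rw [zpow_negSucc, ← inv_pow, Units.val_pow_eq_pow_val]
    simp [unitT, Int.negSucc_eq]

/-- The coefficients of a Laurent polynomial, listed along an enumeration of `ℤ`. -/
noncomputable def coeffSeq : ℤ[T;T⁻¹] ≃+ (ℕ →₀ ℤ) :=
  AddMonoidAlgebra.coeffAddEquiv.trans (Finsupp.domCongr (Denumerable.eqv ℤ))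

lemma coeffSeq_T_symm (n : ℕ) : coeffSeq (T ((Denumerable.eqv ℤ).symm n)) n = 1 := by
  simp [coeffSeq]

end LaurentPolynomial

/-- There are a finitely generated group `Γ` and a `2`-cocycle
`ψ : Γ × Γ → ℤ^{⊕∞}` (trivial action) whose class is not in the image of
`lim→ H²(Γ, ℤ^n) → H²(Γ, ℤ^{⊕∞})`: no cocycle cohomologous to `ψ` takes values in the
initial-coordinate subgroup `ℤ^n` for any `n`. -/
theorem stmt_14 : ∃ (Γ : Type) (instΓ : Group Γ), @Stmt14Prop Γ instΓ := by
  open UnitriangularModCorner LaurentPolynomial in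
  refine ⟨generatedBy unitT, inferInstance, fg_generatedBy _,
    fun a b => coeffSeq (cornerCocycle a.1 b.1), fun a b c => ?_, fun n φ hφ => ?_⟩
  · simpa only [map_add, Subgroup.coe_mul] using congrArg coeffSeq (cornerCocycle_add a.1 b.1 c.1)
  · let k := (Denumerable.eqv ℤ).symm n
    let a : generatedBy unitT := ⟨_, upper_zpow_mem_generatedBy unitT k⟩
    let b : generatedBy unitT := ⟨_, right_mem_generatedBy unitT⟩
    have hab : a * b = b * a := Subtype.ext (by simp [a, b])
    have key := DFunLike.congr_fun (sub_coboundary_sub_swap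
      (fun a b : generatedBy unitT => coeffSeq (cornerCocycle a.1 b.1)) φ hab) n
    rw [Finsupp.sub_apply, hφ a b n le_rfl, hφ b a n le_rfl] at key
    simp [a, b, k, cornerCocycle, val_unitT_zpow, coeffSeq_T_symm] at key
end

section
/- There exists a finitely generated group Γ with the following property. Let G = (ℝ/ℤ)^ℕ × Γ, equipped with the Haar measure given by the product of the Haar probability measure on (ℝ/ℤ)^ℕ and counting measure on Γ, acting trivially on A = ℝ/ℤ, and for N ∈ ℕ let K_N ≤ G be the subgroup {0}^N × (ℝ/ℤ)^{ℕ∖{1,…,N}} × {1}. Then there is a Borel 3-cocycle ψ : G³ → ℝ/ℤ such that for every N ∈ ℕ there are no Borel 3-cocycle ψ′ : G³ → ℝ/ℤ that is invariant under translation of each of its three arguments by elements of K_N, and no Borel map φ : G² → ℝ/ℤ, with ψ = ψ′ + dφ almost everywhere. (That is, the direct limit of the inflation maps H³_m((ℝ/ℤ)^N × Γ, ℝ/ℤ) → H³_m((ℝ/ℤ)^ℕ × Γ, ℝ/ℤ) is not surjective.) -/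
open MeasureTheory

/-- The inhomogeneous coboundary of a `p`-cochain `φ : G^p → A` over an additive group
`G`, with respect to an action `T : G → A → A`. -/
noncomputable def cobndAdd {G A : Type*} [AddGroup G] [AddCommGroup A]
    (T : G → A → A) (p : ℕ) (φ : (Fin p → G) → A) :
    (Fin (p + 1) → G) → A :=
  fun g =>
    T (g 0) (φ fun i => g i.succ)
      + ∑ i : Fin p, ((-1 : ℤ) ^ (i.val + 1)) •
          φ (fun j =>
              if j.val < i.val then g j.castSucc
              else if j.val = i.val then g j.castSucc + g j.succ
              else g j.succ)
      + ((-1 : ℤ) ^ (p + 1)) • φ (fun j => g j.castSucc)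

/-- The property required of `Γ` in Statement 15.  With `G = (ℝ/ℤ)^ℕ × Γ` carrying the
Haar measure `μ = ν ⊗ count` (`ν` any Haar probability measure on `(ℝ/ℤ)^ℕ`), acting
trivially on `A = ℝ/ℤ`, and `K_N = {0}^N × (ℝ/ℤ)^{ℕ∖{0,…,N-1}} × {0}`, there is a Borel
`3`-cocycle `ψ : G³ → ℝ/ℤ` which is not cohomologous to any Borel `3`-cocycle invariant
under translation of each argument by elements of `K_N`, for any `N`. -/
def Stmt15Prop (Γ : Type) [AddGroup Γ] [Countable Γ]
    [MeasurableSpace Γ] [DiscreteMeasurableSpace Γ] : Prop :=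
  ∀ (ν : Measure (ℕ → AddCircle (1 : ℝ)))
    [ν.IsAddHaarMeasure] [IsProbabilityMeasure ν],
    ∃ ψ : (Fin 3 → ((ℕ → AddCircle (1 : ℝ)) × Γ)) → AddCircle (1 : ℝ),
      Measurable ψ ∧
      (cobndAdd (fun _ a => a) 3 ψ
          =ᵐ[Measure.pi fun _ : Fin 4 => ν.prod Measure.count] 0) ∧
      ∀ N : ℕ,
        ¬ ∃ (ψ' : (Fin 3 → ((ℕ → AddCircle (1 : ℝ)) × Γ)) → AddCircle (1 : ℝ))
            (φ : (Fin 2 → ((ℕ → AddCircle (1 : ℝ)) × Γ)) → AddCircle (1 : ℝ)),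
          Measurable ψ' ∧
          -- `ψ'` is invariant under translation of each argument by elements of `K_N`:
          (∀ g k : Fin 3 → ((ℕ → AddCircle (1 : ℝ)) × Γ),
            (∀ i, (k i).2 = 0 ∧ ∀ j < N, (k i).1 j = 0) →
            ψ' (fun i => g i + k i) = ψ' g) ∧
          (cobndAdd (fun _ a => a) 3 ψ'
              =ᵐ[Measure.pi fun _ : Fin 4 => ν.prod Measure.count] 0) ∧
          Measurable φ ∧
          ψ =ᵐ[Measure.pi fun _ : Fin 3 => ν.prod Measure.count]
            fun g => ψ' g + cobndAdd (fun _ a => a) 2 φ g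

/-- The integral lamplighter group `ℤ ≀ ℤ`, written additively. -/
@[ext]
structure WreathInt where
  /-- The finitely supported configuration. -/
  lamp : ℤ →₀ ℤ
  /-- The position of the lamplighter. -/
  pos : ℤ

namespace WreathInt

/-- Translation of a configuration by `m`. -/
noncomputable def shift (m : ℤ) : (ℤ →₀ ℤ) →ₗ[ℤ] (ℤ →₀ ℤ) :=
  Finsupp.lmapDomain ℤ ℤ (m + ·)

lemma shift_single (m i a : ℤ) :
    shift m (Finsupp.single i a) = Finsupp.single (m + i) a := by
  simp [shift]

lemma shift_zero (v : ℤ →₀ ℤ) : shift 0 v = v := by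
  induction v using Finsupp.induction_linear with
  | zero => simp
  | add v w hv hw => simp only [map_add, hv, hw]
  | single i a => simp only [shift_single, zero_add]

lemma shift_add (m n : ℤ) (v : ℤ →₀ ℤ) : shift (m + n) v = shift m (shift n v) := by
  induction v using Finsupp.induction_linear with
  | zero => simp
  | add v w hv hw => simp only [map_add, hv, hw]
  | single i a => simp only [shift_single, add_assoc]

noncomputable instance : Add WreathInt := ⟨fun a b => ⟨a.lamp + shift a.pos b.lamp, a.pos + b.pos⟩⟩

noncomputable instance : Zero WreathInt := ⟨⟨0, 0⟩⟩

noncomputable instance : Neg WreathInt := ⟨fun a => ⟨-shift (-a.pos) a.lamp, -a.pos⟩⟩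

@[simp] lemma add_lamp (a b : WreathInt) : (a + b).lamp = a.lamp + shift a.pos b.lamp := rfl

@[simp] lemma add_pos (a b : WreathInt) : (a + b).pos = a.pos + b.pos := rfl

@[simp] lemma zero_lamp : (0 : WreathInt).lamp = 0 := rfl

@[simp] lemma zero_pos : (0 : WreathInt).pos = 0 := rfl

@[simp] lemma neg_lamp (a : WreathInt) : (-a).lamp = -shift (-a.pos) a.lamp := rfl

@[simp] lemma neg_pos (a : WreathInt) : (-a).pos = -a.pos := rfl

noncomputable instance : AddGroup WreathInt :=
  AddGroup.ofLeftAxioms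
    (fun a b c => by ext1 <;> simp [add_assoc, shift_add])
    (fun a => by ext1 <;> simp [shift_zero])
    (fun a => by ext1 <;> simp)

instance : Countable WreathInt :=
  Function.Injective.countable (f := fun a : WreathInt => (a.lamp, a.pos))
    (fun _ _ h => WreathInt.ext (congrArg Prod.fst h) (congrArg Prod.snd h))

instance : MeasurableSpace WreathInt := ⊤

instance : DiscreteMeasurableSpace WreathInt := ⟨fun _ => trivial⟩

/-- The inclusion of the base group of the wreath product. -/
noncomputable def ofLamp : (ℤ →₀ ℤ) →+ WreathInt where
  toFun v := ⟨v, 0⟩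
  map_zero' := rfl
  map_add' v w := by ext1 <;> simp [shift_zero]

/-- The inclusion of the acting group of the wreath product. -/
noncomputable def ofPos : ℤ →+ WreathInt where
  toFun m := ⟨0, m⟩
  map_zero' := rfl
  map_add' v w := by ext1 <;> simp

@[simp] lemma ofLamp_lamp (v : ℤ →₀ ℤ) : (ofLamp v).lamp = v := rfl

@[simp] lemma ofLamp_pos (v : ℤ →₀ ℤ) : (ofLamp v).pos = 0 := rfl

@[simp] lemma ofPos_lamp (m : ℤ) : (ofPos m).lamp = 0 := rfl

@[simp] lemma ofPos_pos (m : ℤ) : (ofPos m).pos = m := rfl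

lemma fg : AddGroup.FG WreathInt := by
  classical
  refine ⟨⟨{ofLamp (Finsupp.single 0 1), ofPos 1}, ?_⟩⟩
  rw [eq_top_iff]
  rintro a -
  set S := AddSubgroup.closure
    (({ofLamp (Finsupp.single 0 1), ofPos 1} : Finset WreathInt) : Set WreathInt) with hS
  have hpos (m : ℤ) : ofPos m ∈ S := by
    have h : m • ofPos 1 ∈ S := S.zsmul_mem (AddSubgroup.subset_closure (by simp)) m
    rwa [← map_zsmul, smul_eq_mul, mul_one] at h
  have hlamp (v : ℤ →₀ ℤ) : ofLamp v ∈ S := by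
    induction v using Finsupp.induction_linear with
    | zero => rw [map_zero]; exact S.zero_mem
    | add v w hv hw => rw [map_add]; exact S.add_mem hv hw
    | single i a =>
      have h : a • ofLamp (Finsupp.single 0 1) ∈ S :=
        S.zsmul_mem (AddSubgroup.subset_closure (by simp)) a
      rw [← map_zsmul] at h
      have e : ofLamp (Finsupp.single i a)
          = ofPos i + ofLamp (a • Finsupp.single 0 1) + ofPos (-i) := by
        ext1
        · simp [shift_single]
        · simp
      rw [e]
      exact S.add_mem (S.add_mem (hpos i) h) (hpos (-i))
  have e : a = ofLamp a.lamp + ofPos a.pos := by ext1 <;> simp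
  rw [e]
  exact S.add_mem (hlamp _) (hpos _)

/-- The bilinear form on configurations whose value on the basis vectors `i`, `j` is the
coordinate of `x` of index `(j - i).toNat`. -/
noncomputable def toeplitz {A : Type*} [AddCommGroup A] (x : ℕ → A) :
    (ℤ →₀ ℤ) →ₗ[ℤ] (ℤ →₀ ℤ) →ₗ[ℤ] A :=
  Finsupp.linearCombination ℤ fun i => Finsupp.linearCombination ℤ fun j => x (j - i).toNat

section toeplitz

variable {A : Type*} [AddCommGroup A]

lemma toeplitz_single_single (x : ℕ → A) (i j a b : ℤ) :
    toeplitz x (Finsupp.single i a) (Finsupp.single j b) = a • b • x (j - i).toNat := by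
  simp [toeplitz]

lemma toeplitz_add (x y : ℕ → A) (v w : ℤ →₀ ℤ) :
    toeplitz (x + y) v w = toeplitz x v w + toeplitz y v w := by
  induction v using Finsupp.induction_linear with
  | zero => simp
  | add v v' h h' => simp only [map_add, LinearMap.add_apply, h, h']; abel
  | single i a =>
    induction w using Finsupp.induction_linear with
    | zero => simp
    | add v v' h h' => simp only [map_add, h, h']; abel
    | single j b => simp [toeplitz_single_single]

lemma toeplitz_zero (v w : ℤ →₀ ℤ) : toeplitz (0 : ℕ → A) v w = 0 := by
  simpa using toeplitz_add (0 : ℕ → A) 0 v w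

lemma toeplitz_shift (x : ℕ → A) (m : ℤ) (v w : ℤ →₀ ℤ) :
    toeplitz x (shift m v) (shift m w) = toeplitz x v w := by
  induction v using Finsupp.induction_linear with
  | zero => simp
  | add v v' h h' => simp only [map_add, LinearMap.add_apply, h, h']
  | single i a =>
    induction w using Finsupp.induction_linear with
    | zero => simp
    | add v v' h h' => simp only [map_add, h, h']
    | single j b => simp [toeplitz_single_single, shift_single]

lemma measurable_toeplitz [MeasurableSpace A] [MeasurableAdd₂ A] [MeasurableConstSMul ℤ A]
    (v w : ℤ →₀ ℤ) : Measurable fun x : ℕ → A => toeplitz x v w := by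
  induction v using Finsupp.induction_linear with
  | zero => simp
  | add v v' h h' => simp only [map_add, LinearMap.add_apply]; exact h.add h'
  | single i a =>
    induction w using Finsupp.induction_linear with
    | zero => simp
    | add v v' h h' => simp only [map_add]; exact h.add h'
    | single j b =>
      simp only [toeplitz_single_single]
      exact ((measurable_pi_apply _).const_smul b).const_smul a

/-- The cup product of the `2`-cocycle on `ℤ ≀ ℤ` given by the universal Toeplitz form with the
tautological pairing. -/
noncomputable def cupCocycle (g : Fin 3 → (ℕ → A) × WreathInt) : A :=
  toeplitz (g 2).1 (g 0).2.lamp (shift (g 0).2.pos (g 1).2.lamp)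

lemma measurable_cupCocycle [MeasurableSpace A] [MeasurableAdd₂ A] [MeasurableConstSMul ℤ A] :
    Measurable (cupCocycle (A := A)) := by
  unfold cupCocycle
  let F : (ℕ → A) × (WreathInt × WreathInt) → A := fun p =>
    toeplitz p.1 p.2.1.lamp (shift p.2.1.pos p.2.2.lamp)
  have hF : Measurable F := by
    refine measurable_from_prod_countable_left fun q => ?_
    exact measurable_toeplitz q.1.lamp (shift q.1.pos q.2.lamp)
  let G : (Fin 3 → (ℕ → A) × WreathInt) → (ℕ → A) × (WreathInt × WreathInt) :=
    fun g => ((g 2).1, ((g 0).2, (g 1).2))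
  have hG : Measurable G := by
    have hp (i : Fin 3) : Measurable fun g : Fin 3 → (ℕ → A) × WreathInt => g i :=
      measurable_pi_apply i
    exact (hp 2).fst.prodMk ((hp 0).snd.prodMk (hp 1).snd)
  exact Measurable.comp (g := F) (f := G) hF hG

lemma cobndAdd_cupCocycle : cobndAdd (fun _ a => a) 3 (cupCocycle (A := A)) = 0 := by
  funext g
  simp [cobndAdd, Fin.sum_univ_three, cupCocycle, toeplitz_add, toeplitz_shift, shift_add]
  abel

end toeplitz

end WreathInt

section Cochains

variable {H A : Type*} [AddGroup H] [AddCommGroup A]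

/-- The inhomogeneous coboundary of a `2`-cochain for the trivial action, in curried form. -/
def coboundaryTwo (Φ : H → H → A) (a b c : H) : A :=
  Φ b c - Φ (a + b) c + Φ a (b + c) - Φ a b

lemma cobndAdd_two (φ : (Fin 2 → H) → A) (g : Fin 3 → H) :
    cobndAdd (fun _ a => a) 2 φ g
      = coboundaryTwo (fun a b => φ ![a, b]) (g 0) (g 1) (g 2) := by
  have e (f : Fin 2 → H) : φ f = φ ![f 0, f 1] := by
    congr 1; funext i; fin_cases i <;> rfl
  simp only [cobndAdd, Fin.sum_univ_two, coboundaryTwo]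
  rw [e (fun i => g i.succ), e (fun j => g j.castSucc), e (fun j => if j.val < (0 : Fin 2).val then _ else _),
    e (fun j => if j.val < (1 : Fin 2).val then _ else _)]
  simp
  abel

end Cochains

/-- If translating the arguments of a coboundary by `k` one at a time changes nothing in the first
two slots, then the change in the third slot is symmetric in the first two arguments. Only finitely
many instances of the hypotheses are needed. -/
lemma coboundaryTwo_shift_symm {H A : Type*} [AddCommGroup H] [AddCommGroup A] (Φ : H → H → A)
    (k g h w u : H) (c₁ c₂ : A)
    (first : ∀ p q, (p, q) ∈ ({(g + w, h - w), (w, h - w), (h + w, g - w), (w, g - w), (h, w),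
      (g, w)} : Set (H × H)) →
      coboundaryTwo Φ (u + k) (p - u) q - coboundaryTwo Φ u (p - u) q = 0)
    (second : ∀ p q r, (p, q, r) ∈ ({(g, h, w), (h, g, w), (g, w, h - w), (h, w, g - w)} :
      Set (H × H × H)) →
      coboundaryTwo Φ p (q + k) r - coboundaryTwo Φ p q r = 0)
    (third : coboundaryTwo Φ g h (w + k) - coboundaryTwo Φ g h w = c₁)
    (third' : coboundaryTwo Φ h g (w + k) - coboundaryTwo Φ h g w = c₂) :
    c₁ = c₂ := by
  have L1 (p q) (hpq : (p, q) ∈ ({(g + w, h - w), (w, h - w), (h + w, g - w), (w, g - w), (h, w),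
      (g, w)} : Set (H × H))) : Φ (p + k) q - Φ p q
        = (Φ (u + k) (p + q - u) - Φ u (p + q - u)) - (Φ (u + k) (p - u) - Φ u (p - u)) := by
    have e := first p q hpq
    rw [coboundaryTwo, coboundaryTwo, show u + k + (p - u) = p + k by abel,
      show u + (p - u) = p by abel, show p - u + q = p + q - u by abel] at e
    rw [← sub_eq_zero, ← neg_eq_zero, ← e]
    abel
  have L2 (p q r) (hpqr : (p, q, r) ∈ ({(g, h, w), (h, g, w), (g, w, h - w), (h, w, g - w)} :
      Set (H × H × H))) : (Φ p (q + r + k) - Φ p (q + r)) - (Φ p (q + k) - Φ p q)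
        = (Φ (p + q + k) r - Φ (p + q) r) - (Φ (q + k) r - Φ q r) := by
    have e := second p q r hpqr
    rw [coboundaryTwo, coboundaryTwo, show p + (q + k) = p + q + k by abel,
      show q + k + r = q + r + k by abel] at e
    rw [← sub_eq_zero, ← e]
    abel
  have a₁ := L1 (g + w) (h - w) (by simp)
  have a₂ := L1 w (h - w) (by simp)
  have a₃ := L1 (h + w) (g - w) (by simp)
  have a₄ := L1 w (g - w) (by simp)
  have a₅ := L1 h w (by simp)
  have a₆ := L1 g w (by simp)
  have b₁ := L2 g h w (by simp)
  have b₂ := L2 h g w (by simp)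
  have b₃ := L2 g w (h - w) (by simp)
  have b₄ := L2 h w (g - w) (by simp)
  rw [coboundaryTwo, coboundaryTwo, show h + (w + k) = h + w + k by abel] at third
  rw [coboundaryTwo, coboundaryTwo, show g + (w + k) = g + w + k by abel, add_comm h g] at third'
  rw [show g + w + (h - w) = g + h by abel] at a₁
  rw [show w + (h - w) = h by abel] at a₂ b₃
  rw [show h + w + (g - w) = g + h by abel] at a₃
  rw [show w + (g - w) = g by abel] at a₄ b₄
  rw [add_comm h g] at b₂
  subst third third'
  grind

open WreathInt

section Generic

variable {X Γ : Type*} [MeasurableSpace X] {ν : Measure X}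

lemma ae_pi_of_ae_pi_prod_count {ι : Type*} [Fintype ι] [SigmaFinite ν] [Countable Γ]
    [MeasurableSpace Γ] [DiscreteMeasurableSpace Γ] {P : (ι → X × Γ) → Prop}
    (h : ∀ᵐ g ∂Measure.pi fun _ : ι => ν.prod Measure.count, P g) (γ : ι → Γ) :
    ∀ᵐ x ∂Measure.pi fun _ : ι => ν, P fun i => (x i, γ i) := by
  have hm (i : ι) : Measurable fun x : X => (x, γ i) := by fun_prop
  have e (i : ι) : ν.map (fun x => (x, γ i))
      = (ν.prod Measure.count).restrict (Set.univ ×ˢ {γ i}) := by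
    rw [← Measure.prod_restrict, Measure.restrict_univ, Measure.restrict_singleton,
      Measure.count_singleton, one_smul, Measure.prod_dirac]
  have (i : ι) : SigmaFinite (ν.map fun x => (x, γ i)) := by rw [e]; infer_instance
  have key : (Measure.pi fun _ : ι => ν).map (fun x i => (x i, γ i))
      ≪ Measure.pi fun _ : ι => ν.prod Measure.count := by
    rw [Measure.pi_map_pi fun i => (hm i).aemeasurable]
    simp_rw [e]
    rw [← Measure.restrict_pi_pi]
    exact Measure.restrict_le_self.absolutelyContinuous
  exact Measure.QuasiMeasurePreserving.ae ⟨by fun_prop, key⟩ h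

lemma ae_pi_matrix [AddCommGroup X] [TopologicalSpace X] [IsTopologicalAddGroup X]
    [CompactSpace X] [SecondCountableTopology X] [BorelSpace X] [ν.IsAddHaarMeasure]
    [IsProbabilityMeasure ν] {m n : ℕ} (M : Matrix (Fin m) (Fin n) ℤ)
    (hM : ∃ N : Matrix (Fin n) (Fin m) ℤ, M * N = 1) (s : Fin m → X) {P : (Fin m → X) → Prop}
    (h : ∀ᵐ y ∂Measure.pi fun _ : Fin m => ν, P y) :
    ∀ᵐ x ∂Measure.pi fun _ : Fin n => ν, P fun i => ∑ j, M i j • x j + s i := by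
  let f : (Fin n → X) →+ (Fin m → X) :=
    { toFun := fun x i => ∑ j, M i j • x j
      map_zero' := by funext i; simp
      map_add' := fun x y => by funext i; simp [Finset.sum_add_distrib] }
  have hf : Continuous f := by
    change Continuous fun (x : Fin n → X) i => ∑ j, M i j • x j
    fun_prop
  have hs : Function.Surjective f := by
    obtain ⟨N, hN⟩ := hM
    intro y
    refine ⟨fun j => ∑ l, N j l • y l, ?_⟩
    funext i
    change ∑ j, M i j • ∑ l, N j l • y l = y i
    simp_rw [Finset.smul_sum, smul_smul]
    rw [Finset.sum_comm]
    simp_rw [← Finset.sum_smul, ← Matrix.mul_apply, hN, Matrix.one_apply]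
    simp
  have hp : MeasurePreserving f (Measure.pi fun _ => ν) (Measure.pi fun _ => ν) :=
    AddMonoidHom.measurePreserving hf hs (by simp)
  exact ((measurePreserving_add_right _ s).comp hp).quasiMeasurePreserving.ae h

end Generic

/-- The integral combinations of a family in `X`, with an additional component carried along. -/
def intCombination {X V : Type*} [AddCommGroup X] [AddCommGroup V] {n : ℕ} (x : Fin n → X) :
    (Fin n → ℤ) × V →+ X × V where
  toFun p := (∑ j, p.1 j • x j, p.2)
  map_zero' := by simp
  map_add' p q := by simp [add_smul, Finset.sum_add_distrib]

local notation "Torus" => ℕ → AddCircle (1 : ℝ)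

/-- A `2`-cochain on `X × (ℤ ≀ ℤ)`, restricted to the product of `X` and the base group. -/
noncomputable def restrictBase {X A : Type*} (φ : (Fin 2 → X × WreathInt) → A)
    (p q : X × (ℤ →₀ ℤ)) : A :=
  φ ![(p.1, ofLamp p.2), (q.1, ofLamp q.2)]

lemma coboundaryTwo_restrictBase {X A : Type*} [AddGroup X] [AddCommGroup A]
    (φ : (Fin 2 → X × WreathInt) → A) (g : Fin 3 → X × (ℤ →₀ ℤ)) :
    cobndAdd (fun _ a => a) 2 φ (fun i => ((g i).1, ofLamp (g i).2))
      = coboundaryTwo (restrictBase φ) (g 0) (g 1) (g 2) := by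
  simp [cobndAdd_two, coboundaryTwo, restrictBase]

lemma ae_coboundaryTwo_shift {ν : Measure Torus} [ν.IsAddHaarMeasure] [IsProbabilityMeasure ν]
    {ψ' : (Fin 3 → Torus × WreathInt) → AddCircle (1 : ℝ)}
    {φ : (Fin 2 → Torus × WreathInt) → AddCircle (1 : ℝ)}
    (h : cupCocycle =ᵐ[Measure.pi fun _ : Fin 3 => ν.prod Measure.count]
      fun g => ψ' g + cobndAdd (fun _ a => a) 2 φ g)
    {k : Fin 3 → Torus}
    (hk : ∀ g : Fin 3 → Torus × WreathInt, ψ' (fun i => g i + (k i, 0)) = ψ' g)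
    {n : ℕ} (p : Fin 3 → (Fin n → ℤ) × (ℤ →₀ ℤ))
    (hp : ∃ N : Matrix (Fin n) (Fin 3) ℤ, (Matrix.of fun i => (p i).1) * N = 1) :
    ∀ᵐ x ∂Measure.pi fun _ : Fin n => ν,
      coboundaryTwo (restrictBase φ) (intCombination x (p 0) + (k 0, 0))
          (intCombination x (p 1) + (k 1, 0)) (intCombination x (p 2) + (k 2, 0))
        - coboundaryTwo (restrictBase φ) (intCombination x (p 0)) (intCombination x (p 1))
          (intCombination x (p 2))
        = toeplitz (k 2) (p 0).2 (p 1).2 := by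
  have h₁ := ae_pi_of_ae_pi_prod_count h fun i => ofLamp (p i).2
  filter_upwards [ae_pi_matrix _ hp 0 h₁, ae_pi_matrix _ hp k h₁] with x e₀ e₁
  have e₂ := hk fun i => (∑ j, (p i).1 j • x j, ofLamp (p i).2)
  simp only [Prod.mk_add_mk, add_zero] at e₂
  have c₀ := coboundaryTwo_restrictBase φ fun i => intCombination x (p i)
  have c₁ := coboundaryTwo_restrictBase φ fun i => intCombination x (p i) + (k i, 0)
  simp only [intCombination, AddMonoidHom.coe_mk, ZeroHom.coe_mk, Prod.mk_add_mk, add_zero]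
    at c₀ c₁ ⊢
  simp only [Matrix.of_apply, Pi.zero_apply, add_zero] at e₀ e₁
  rw [c₀] at e₀
  rw [c₁, e₂] at e₁
  rw [eq_sub_of_add_eq' e₀.symm, eq_sub_of_add_eq' e₁.symm, sub_sub_sub_cancel_right]
  simp only [cupCocycle, ofLamp_lamp, ofLamp_pos, shift_zero]
  change toeplitz ((∑ j, (p 2).1 j • x j) + k 2) _ _ - _ = _
  rw [toeplitz_add, add_sub_cancel_left]

lemma toeplitz_symm_of_cohomologous {ν : Measure Torus} [ν.IsAddHaarMeasure]
    [IsProbabilityMeasure ν]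
    {ψ' : (Fin 3 → Torus × WreathInt) → AddCircle (1 : ℝ)}
    {φ : (Fin 2 → Torus × WreathInt) → AddCircle (1 : ℝ)}
    (h : cupCocycle =ᵐ[Measure.pi fun _ : Fin 3 => ν.prod Measure.count]
      fun g => ψ' g + cobndAdd (fun _ a => a) 2 φ g)
    {κ : Torus}
    (hκ : ∀ i, ∀ g : Fin 3 → Torus × WreathInt,
      ψ' (fun j => g j + ((Pi.single i κ : Fin 3 → Torus) j, 0)) = ψ' g) (v w : ℤ →₀ ℤ) :
    toeplitz κ v w = toeplitz κ w v := by
  let a : (Fin 4 → ℤ) × (ℤ →₀ ℤ) := (![1, 0, 0, 0], v)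
  let b : (Fin 4 → ℤ) × (ℤ →₀ ℤ) := (![0, 1, 0, 0], w)
  let c : (Fin 4 → ℤ) × (ℤ →₀ ℤ) := (![0, 0, 1, 0], 0)
  let d : (Fin 4 → ℤ) × (ℤ →₀ ℤ) := (![0, 0, 0, 1], 0)
  have key (i p hp) := ae_coboundaryTwo_shift h (hκ i) (n := 4) p hp
  have H : ∀ᵐ x ∂Measure.pi fun _ : Fin 4 => ν, toeplitz κ v w = toeplitz κ w v := by
    filter_upwards [
      key 0 ![d, a + c - d, b - c] ⟨!![1, 1, 0; 0, 0, 1; 0, 0, 0; 1, 0, 0], by ext i j; fin_cases i <;> fin_cases j <;> rfl⟩,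
      key 0 ![d, c - d, b - c] ⟨!![0, 0, 0; 1, 1, 1; 1, 1, 0; 1, 0, 0], by ext i j; fin_cases i <;> fin_cases j <;> rfl⟩,
      key 0 ![d, b + c - d, a - c] ⟨!![0, 0, 1; 1, 1, 0; 0, 0, 0; 1, 0, 0], by ext i j; fin_cases i <;> fin_cases j <;> rfl⟩,
      key 0 ![d, c - d, a - c] ⟨!![1, 1, 1; 0, 0, 0; 1, 1, 0; 1, 0, 0], by ext i j; fin_cases i <;> fin_cases j <;> rfl⟩,
      key 0 ![d, b - d, c] ⟨!![0, 0, 0; 1, 1, 0; 0, 0, 1; 1, 0, 0], by ext i j; fin_cases i <;> fin_cases j <;> rfl⟩,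
      key 0 ![d, a - d, c] ⟨!![1, 1, 0; 0, 0, 0; 0, 0, 1; 1, 0, 0], by ext i j; fin_cases i <;> fin_cases j <;> rfl⟩,
      key 1 ![a, b, c] ⟨!![1, 0, 0; 0, 1, 0; 0, 0, 1; 0, 0, 0], by ext i j; fin_cases i <;> fin_cases j <;> rfl⟩,
      key 1 ![b, a, c] ⟨!![0, 1, 0; 1, 0, 0; 0, 0, 1; 0, 0, 0], by ext i j; fin_cases i <;> fin_cases j <;> rfl⟩,
      key 1 ![a, c, b - c] ⟨!![1, 0, 0; 0, 1, 1; 0, 1, 0; 0, 0, 0], by ext i j; fin_cases i <;> fin_cases j <;> rfl⟩,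
      key 1 ![b, c, a - c] ⟨!![0, 1, 1; 1, 0, 0; 0, 1, 0; 0, 0, 0], by ext i j; fin_cases i <;> fin_cases j <;> rfl⟩,
      key 2 ![a, b, c] ⟨!![1, 0, 0; 0, 1, 0; 0, 0, 1; 0, 0, 0], by ext i j; fin_cases i <;> fin_cases j <;> rfl⟩,
      key 2 ![b, a, c] ⟨!![0, 1, 0; 1, 0, 0; 0, 0, 1; 0, 0, 0], by ext i j; fin_cases i <;> fin_cases j <;> rfl⟩]
      with x f₁ f₂ f₃ f₄ f₅ f₆ s₁ s₂ s₃ s₄ t₁ t₂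
    have z : (((0 : Torus), (0 : ℤ →₀ ℤ))) = 0 := rfl
    simp [z, toeplitz_zero, map_add, map_sub] at f₁ f₂ f₃ f₄ f₅ f₆ s₁ s₂ s₃ s₄ t₁ t₂
    refine coboundaryTwo_shift_symm (restrictBase φ) (κ, 0) (intCombination x a)
      (intCombination x b) (intCombination x c) (intCombination x d) _ _ ?_ ?_ t₁ t₂
    · simp only [Set.mem_insert_iff, Set.mem_singleton_iff, Prod.mk.injEq]
      rintro p q (⟨rfl, rfl⟩ | ⟨rfl, rfl⟩ | ⟨rfl, rfl⟩ | ⟨rfl, rfl⟩ | ⟨rfl, rfl⟩ | ⟨rfl, rfl⟩)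
      exacts [f₁, f₂, f₃, f₄, f₅, f₆]
    · simp only [Set.mem_insert_iff, Set.mem_singleton_iff, Prod.mk.injEq]
      rintro p q r (⟨rfl, rfl, rfl⟩ | ⟨rfl, rfl, rfl⟩ | ⟨rfl, rfl, rfl⟩ | ⟨rfl, rfl, rfl⟩)
      exacts [s₁, s₂, s₃, s₄]
  exact H.exists.choose_spec

/-- There is a finitely generated group `Γ` such that the direct limit
of the inflation maps `H³_m((ℝ/ℤ)^N × Γ, ℝ/ℤ) → H³_m((ℝ/ℤ)^ℕ × Γ, ℝ/ℤ)` is not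
surjective. -/
theorem stmt_15 :
    ∃ (Γ : Type) (i1 : AddGroup Γ) (i2 : Countable Γ)
      (i3 : MeasurableSpace Γ) (_i4 : @DiscreteMeasurableSpace Γ i3),
      @AddGroup.FG Γ i1 ∧ @Stmt15Prop Γ i1 i2 i3 _i4 := by
  refine ⟨WreathInt, inferInstance, inferInstance, inferInstance, inferInstance, WreathInt.fg,
    fun ν _ _ => ⟨cupCocycle, measurable_cupCocycle, ?_, fun N => ?_⟩⟩
  · rw [cobndAdd_cupCocycle]
  rintro ⟨ψ', φ, -, hinv, -, -, h⟩
  let κ : Torus := Pi.single (N + 1) ((1 / 2 : ℝ) : AddCircle (1 : ℝ))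
  have hκ : ∀ j < N, κ j = 0 := fun j hj => Pi.single_eq_of_ne (by omega) _
  have hsymm := toeplitz_symm_of_cohomologous h (κ := κ)
    (fun i g => hinv g _ fun j => ⟨rfl, fun l hl => by
      by_cases hij : j = i
      · subst hij; simp [hκ l hl]
      · simp [hij]⟩)
    (Finsupp.single 0 1) (Finsupp.single (N + 1) 1)
  have h₀ : κ 0 = 0 := Pi.single_eq_of_ne (by omega) _
  have h₁ : κ (N + 1) = ((1 / 2 : ℝ) : AddCircle (1 : ℝ)) := Pi.single_eq_same _ _
  have e₁ : ((N : ℤ) + 1 - 0).toNat = N + 1 := by omega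
  have e₂ : (0 - ((N : ℤ) + 1)).toNat = 0 := by omega
  rw [toeplitz_single_single, toeplitz_single_single, e₁, e₂, h₀, h₁] at hsymm
  simp only [one_smul] at hsymm
  obtain ⟨n, hn⟩ := (AddCircle.coe_eq_zero_iff (1 : ℝ)).1 hsymm
  have hn' : ((2 * n : ℤ) : ℝ) = ((1 : ℤ) : ℝ) := by
    push_cast
    simp only [zsmul_eq_mul, mul_one] at hn
    linarith
  have := Int.cast_injective hn'
  omega
end

section
/- Let α, β ∈ ℝ be irrational and rationally independent, let A = ℝ × ℤ², and let ℝ act on A by T^t(s,m,n) = (s + tαm + tβn, m, n). Then: (i) a continuous map b : ℝ → A satisfies the crossed-homomorphism identity b(t+u) = b(t) + T^t(b(u)) for all t, u ∈ ℝ if and only if there is c ∈ ℝ such that b(t) = (ct, 0, 0) for all t; (ii) for c ∈ ℝ, the map t ↦ (ct, 0, 0) is of the form t ↦ T^t(a) − a for some a ∈ A if and only if c ∈ ℤα + ℤβ. Consequently the group of continuous crossed homomorphisms ℝ → A modulo principal crossed homomorphisms is isomorphic to ℝ/(ℤα + ℤβ); in particular, since ℤα + ℤβ is dense in ℝ, the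 quotient topology on this cohomology group H¹_m(ℝ, A) is not Hausdorff. -/
/-- The `ℝ`-action on `A = ℝ × ℤ²` from Statement 18:
`T^t(s,m,n) = (s + tαm + tβn, m, n)`. -/
def Tact (α β : ℝ) (t : ℝ) (x : ℝ × ℤ × ℤ) : ℝ × ℤ × ℤ :=
  (x.1 + t * α * (x.2.1 : ℝ) + t * β * (x.2.2 : ℝ), x.2.1, x.2.2)

/-- A continuous additive map from `ℝ` to a discrete group vanishes. -/
theorem eq_zero_of_continuous_of_map_add {G : Type*} [AddGroup G] [TopologicalSpace G]
    [DiscreteTopology G] {f : ℝ → G} (hf : Continuous f)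
    (hadd : ∀ t u, f (t + u) = f t + f u) (t : ℝ) : f t = 0 := by
  have h0 : f 0 = 0 := by simpa using hadd 0 0
  rw [← h0]
  exact PreconnectedSpace.constant inferInstance hf

/-- A continuous additive map `ℝ → ℝ` is multiplication by a constant. -/
theorem eq_mul_of_continuous_of_map_add {f : ℝ → ℝ} (hf : Continuous f)
    (hadd : ∀ t u, f (t + u) = f t + f u) (t : ℝ) : f t = f 1 * t := by
  simpa [mul_comm] using map_real_smul (AddMonoidHom.mk' f hadd) hf t 1

/-- The group `ℤα + ℤβ` is dense in `ℝ` when `α` and `β` are rationally independent. -/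
theorem dense_setOf_int_combination {α β : ℝ}
    (hind : ∀ m n : ℤ, (m : ℝ) * α + (n : ℝ) * β = 0 → m = 0 ∧ n = 0) :
    Dense {c : ℝ | ∃ m n : ℤ, c = (m : ℝ) * α + (n : ℝ) * β} := by
  have hβ : β ≠ 0 := by
    rintro rfl
    simpa using hind 0 1
  have hirr : Irrational (α / β) := by
    rintro ⟨q, hq⟩
    have hden : (q.den : ℝ) ≠ 0 := by exact_mod_cast q.den_ne_zero
    have h := hind q.den (-q.num) (by
      rw [Rat.cast_def] at hq
      field_simp at hq
      push_cast
      linarith)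
    exact q.den_ne_zero (by exact_mod_cast h.1)
  convert dense_addSubgroupClosure_pair_iff.2 hirr using 1
  ext c
  simp [AddSubgroup.mem_closure_pair, eq_comm]

/-- Let `α, β ∈ ℝ` be irrational and rationally independent and let `ℝ`
act on `A = ℝ × ℤ²` by `T^t(s,m,n) = (s + tαm + tβn, m, n)`.  Then:
(i) a continuous `b : ℝ → A` is a crossed homomorphism iff `b t = (ct, 0, 0)` for some `c`;
(ii) `t ↦ (ct,0,0)` is principal iff `c ∈ ℤα + ℤβ`; and consequently, since `ℤα + ℤβ` is
dense in `ℝ`, `H¹_m(ℝ,A) ≅ ℝ/(ℤα+ℤβ)` is not Hausdorff. -/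
theorem stmt_18 (α β : ℝ) (hα : Irrational α) (hβ : Irrational β)
    (hind : ∀ m n : ℤ, (m : ℝ) * α + (n : ℝ) * β = 0 → m = 0 ∧ n = 0) :
    (∀ b : ℝ → ℝ × ℤ × ℤ, Continuous b →
      ((∀ t u : ℝ, b (t + u) = b t + Tact α β t (b u)) ↔
        ∃ c : ℝ, ∀ t, b t = (c * t, 0, 0)))
    ∧
    (∀ c : ℝ,
      (∃ a : ℝ × ℤ × ℤ, ∀ t : ℝ,
        ((c * t, (0 : ℤ), (0 : ℤ)) : ℝ × ℤ × ℤ) = Tact α β t a - a) ↔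
      ∃ m n : ℤ, c = (m : ℝ) * α + (n : ℝ) * β)
    ∧
    Dense {c : ℝ | ∃ m n : ℤ, c = (m : ℝ) * α + (n : ℝ) * β} := by
  refine ⟨fun b hb => ⟨fun h => ?_, ?_⟩, fun c => ⟨?_, ?_⟩, dense_setOf_int_combination hind⟩
  · have h₂ : ∀ t, (b t).2 = 0 := eq_zero_of_continuous_of_map_add hb.snd fun t u => by
      rw [h]; rfl
    have h₁ : ∀ t, (b t).1 = (b 1).1 * t := eq_mul_of_continuous_of_map_add hb.fst fun t u => by
      rw [h]; simp [Tact, h₂]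
    exact ⟨(b 1).1, fun t => Prod.ext (h₁ t) (h₂ t)⟩
  · rintro ⟨c, hc⟩ t u
    simp [hc, Tact, mul_add]
  · rintro ⟨⟨s, m, n⟩, h⟩
    have h₁ := congrArg Prod.fst (h 1)
    simp only [Tact, Prod.fst_sub] at h₁
    exact ⟨m, n, by linarith⟩
  · rintro ⟨m, n, rfl⟩
    refine ⟨(0, m, n), fun t => ?_⟩
    refine Prod.ext ?_ (sub_self (m, n)).symm
    simp only [Tact, Prod.fst_sub]
    ring
end
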